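/- Let Q be a quandle and N a normal subgroup of Aut(Q). Then the orbit decomposition ∼_N of Q with respect to the action of N is a congruence of Q: if a ∼_N c and b ∼_N d, then a * b ∼_N c * d and a ⊛ b ∼_N c ⊛ d. -/

import Mathlib

/-- If `σ` normalizes `N` and `m, n ∈ N`, then `σ x` and `(m * σ * m⁻¹) (n x)` lie in the same
`N`-orbit. -/
theorem Subgroup.exists_mem_perm_apply_eq_conj_apply {Q : Type*} (N : Subgroup (Equiv.Perm Q))
    (σ : Equiv.Perm Q) (hσ : ∀ n ∈ N, σ * n * σ⁻¹ ∈ N) {m n : Equiv.Perm Q}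
    (hm : m ∈ N) (hn : n ∈ N) (x : Q) :
    ∃ k ∈ N, k (σ x) = (m * σ * m⁻¹) (n x) :=
  ⟨m * (σ * (m⁻¹ * n) * σ⁻¹), N.mul_mem hm (hσ _ (N.mul_mem (N.inv_mem hm) hn)), by
    simp [Equiv.Perm.mul_apply]⟩

/-- For a quandle Q and a normal subgroup N of Aut(Q), the orbit
decomposition ∼_N is a congruence of Q. -/
theorem stmt_6 {Q : Type*} [Nonempty Q] (op : Q → Q → Q)
    (idem : ∀ x, op x x = x)
    (bij : ∀ y, Function.Bijective (fun x => op x y))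
    (dist : ∀ x y z, op (op x y) z = op (op x z) (op y z))
    (N : Subgroup (Equiv.Perm Q))
    (hAut : ∀ n ∈ N, ∀ a b : Q, n (op a b) = op (n a) (n b))
    (hNormal : ∀ g : Equiv.Perm Q, (∀ a b : Q, g (op a b) = op (g a) (g b)) →
      ∀ n ∈ N, g * n * g⁻¹ ∈ N) :
    Equivalence (fun a c : Q => ∃ n ∈ N, n a = c) ∧
    ∀ a b c d : Q, (∃ n ∈ N, n a = c) → (∃ n ∈ N, n b = d) →
      (∃ n ∈ N, n (op a b) = op c d) ∧
      (∃ n ∈ N, n (Function.invFun (fun z => op z b) a) =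
        Function.invFun (fun z => op z d) c) := by
  let R : Q → Equiv.Perm Q := fun y => Equiv.ofBijective _ (bij y)
  have R_apply : ∀ y x, R y x = op x y := fun _ _ => rfl
  have R_aut : ∀ y a b, R y (op a b) = op (R y a) (R y b) := fun y a b => dist a b y
  have R_inv_aut : ∀ y a b, (R y)⁻¹ (op a b) = op ((R y)⁻¹ a) ((R y)⁻¹ b) := fun y a b => by
    rw [Equiv.Perm.inv_eq_iff_eq, R_aut]
    simp
  have invFun_eq : ∀ y x, Function.invFun (fun z => op z y) x = (R y)⁻¹ x := fun y x => by
    rw [Equiv.Perm.eq_inv_iff_eq]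
    exact Function.rightInverse_invFun (bij y).surjective x
  have R_conj : ∀ m ∈ N, ∀ y, R (m y) = m * R y * m⁻¹ := fun m hm y => by
    ext x
    rw [Equiv.Perm.mul_apply, Equiv.Perm.mul_apply, R_apply, R_apply, hAut m hm]
    simp
  refine ⟨⟨fun a => ⟨1, N.one_mem, rfl⟩, ?_, ?_⟩, ?_⟩
  · rintro a _ ⟨n, hn, rfl⟩
    exact ⟨n⁻¹, N.inv_mem hn, n.symm_apply_apply a⟩
  · rintro a _ _ ⟨n, hn, rfl⟩ ⟨m, hm, rfl⟩
    exact ⟨m * n, N.mul_mem hm hn, rfl⟩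
  · rintro a b _ _ ⟨n, hn, rfl⟩ ⟨m, hm, rfl⟩
    constructor
    · rw [← R_apply, ← R_apply, R_conj m hm]
      exact N.exists_mem_perm_apply_eq_conj_apply (R b) (hNormal _ (R_aut b)) hm hn a
    · rw [invFun_eq, invFun_eq, R_conj m hm, conj_inv]
      exact N.exists_mem_perm_apply_eq_conj_apply (R b)⁻¹ (hNormal _ (R_inv_aut b)) hm hn a
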